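/- Let Σ and M be symmetric n×n real matrices. Let λ_1 > λ_2 > λ_3 ≥ … ≥ λ_n be the eigenvalues of Σ with corresponding orthonormal eigenvectors u_1, u_2, …, u_n, and let ũ_1, ũ_2 be orthonormal eigenvectors of M corresponding to its two largest eigenvalues, with signs chosen so that ⟨u_1, ũ_1⟩ ≥ 0 and ⟨u_2, ũ_2⟩ ≥ 0. If ‖M − Σ‖ ≤ ε for some ε < (λ_2 − λ_3)/2, then ‖u_1 − ũ_1‖₂² ≤ 4ε/(λ_1 − λ_2) and ‖u_2 − ũ_2‖₂² ≤ 4ε/(λ_1 − λ_2) + 8ε/(λ_2 − λ_3). -/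

import Mathlib

open scoped RealInnerProductSpace

section Auxiliary

variable {ι E : Type*} [Fintype ι] [NormedAddCommGroup E] [InnerProductSpace ℝ E]

lemma OrthonormalBasis.inner_apply_self_of_eigenvectors (b : OrthonormalBasis ι ℝ E)
    (T : E →L[ℝ] E) (l : ι → ℝ) (hT : ∀ i, T (b i) = l i • b i) (x : E) :
    ⟪x, T x⟫ = ∑ i, l i * ⟪b i, x⟫ ^ 2 := by
  conv_lhs => rw [← b.sum_repr' x, map_sum, b.sum_repr' x, inner_sum]
  refine Finset.sum_congr rfl fun i _ => ?_
  rw [map_smul, hT, inner_smul_right, inner_smul_right, real_inner_comm]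
  ring

lemma abs_inner_apply_sub_inner_apply_le {A B : E →L[ℝ] E} {ε : ℝ} (h : ‖B - A‖ ≤ ε)
    {x : E} (hx : ‖x‖ = 1) : |⟪x, B x⟫ - ⟪x, A x⟫| ≤ ε := by
  rw [← inner_sub_right, ← sub_apply]
  calc |⟪x, (B - A) x⟫| ≤ ‖x‖ * ‖(B - A) x‖ := abs_real_inner_le_norm _ _
    _ ≤ ‖x‖ * (‖B - A‖ * ‖x‖) := by gcongr; exact (B - A).le_opNorm x
    _ ≤ ε := by simpa [hx] using h

lemma Finset.sum_mul_le_of_le_off_subset [DecidableEq ι] (s : Finset ι) {l p : ι → ℝ} {c : ℝ}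
    (hp : ∀ i, 0 ≤ p i) (hl : ∀ i ∉ s, l i ≤ c) :
    ∑ i, l i * p i ≤ ∑ i ∈ s, l i * p i + c * (∑ i, p i - ∑ i ∈ s, p i) := by
  rw [← Finset.sum_add_sum_compl s (fun i => l i * p i), ← Finset.sum_add_sum_compl s p,
    add_sub_cancel_left, Finset.mul_sum]
  gcongr with i hi
  · exact hp i
  · exact hl i (Finset.mem_compl.mp hi)

lemma Orthonormal.inner_sq_add_inner_sq_le {κ : Type*} {v : κ → E} (hv : Orthonormal ℝ v)
    {i j : κ} (hij : i ≠ j) (x : E) : ⟪v i, x⟫ ^ 2 + ⟪v j, x⟫ ^ 2 ≤ ‖x‖ ^ 2 := by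
  classical
  simpa [Finset.sum_pair hij] using hv.sum_inner_products_le (s := {i, j}) (x := x)

lemma norm_sub_sq_le_of_inner_nonneg {x y : E} (hx : ‖x‖ = 1) (hy : ‖y‖ = 1)
    (h : 0 ≤ ⟪x, y⟫) : ‖x - y‖ ^ 2 ≤ 2 * (1 - ⟪x, y⟫ ^ 2) := by
  have h1 : ⟪x, y⟫ ≤ 1 := by simpa [hx, hy] using real_inner_le_norm x y
  rw [norm_sub_sq_real, hx, hy]
  nlinarith

/-- Perturbation bounds for the top two eigenvectors, in terms of eigenbases of two operators. -/
theorem OrthonormalBasis.eigenvector_perturbation_bounds (u w : OrthonormalBasis ι ℝ E)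
    {A B : E →L[ℝ] E} {lam mu : ι → ℝ} (hA : ∀ i, A (u i) = lam i • u i)
    (hB : ∀ i, B (w i) = mu i • w i) {a b : ι} (hab : a ≠ b) {c : ℝ}
    (hgap₁ : lam b < lam a) (hgap₂ : c < lam b) (hlam : ∀ i, i ≠ a → i ≠ b → lam i ≤ c)
    (hmuab : mu b ≤ mu a) (hmu : ∀ i, i ≠ a → mu i ≤ mu b)
    (hsign₁ : 0 ≤ ⟪u a, w a⟫) (hsign₂ : 0 ≤ ⟪u b, w b⟫) {ε : ℝ} (hε : ‖B - A‖ ≤ ε) :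
    ‖u a - w a‖ ^ 2 ≤ 4 * ε / (lam a - lam b) ∧
    ‖u b - w b‖ ^ 2 ≤ 4 * ε / (lam a - lam b) + 8 * ε / (lam b - c) := by
  classical
  have quad (v : OrthonormalBasis ι ℝ E) (T : E →L[ℝ] E) (l : ι → ℝ)
      (hT : ∀ i, T (v i) = l i • v i) (i : ι) : ⟪v i, T (v i)⟫ = l i := by
    simp [hT, inner_smul_right]
  have parseval (v : OrthonormalBasis ι ℝ E) (x : E) (hx : ‖x‖ = 1) :
      ∑ i, ⟪v i, x⟫ ^ 2 = 1 := by
    simpa [hx] using v.sum_sq_norm_inner_right x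
  have hua := u.norm_eq_one a
  have hub := u.norm_eq_one b
  have hwa := w.norm_eq_one a
  have hwb := w.norm_eq_one b
  have e1 := (abs_le.mp (abs_inner_apply_sub_inner_apply_le hε hua)).1
  have e2 := (abs_le.mp (abs_inner_apply_sub_inner_apply_le hε hub)).1
  have e3 := (abs_le.mp (abs_inner_apply_sub_inner_apply_le hε hwa)).2
  have e4 := (abs_le.mp (abs_inner_apply_sub_inner_apply_le hε hwb)).2
  rw [quad u A lam hA] at e1 e2
  rw [quad w B mu hB] at e3 e4
  have hBx := w.inner_apply_self_of_eigenvectors B mu hB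
  have hAx := u.inner_apply_self_of_eigenvectors A lam hA
  have hlam' : ∀ i ∉ ({a} : Finset ι), lam i ≤ lam b := by
    intro i hi
    by_cases hib : i = b
    · rw [hib]
    · exact (hlam i (by simpa using hi) hib).trans hgap₂.le
  have hmu' : ∀ i ∉ ({a} : Finset ι), mu i ≤ mu b := fun i hi => hmu i (by simpa using hi)
  have top : (lam a - lam b) * (1 - ⟪u a, w a⟫ ^ 2) ≤ 2 * ε := by
    have h1 := Finset.sum_mul_le_of_le_off_subset {a} (fun i => sq_nonneg ⟪u i, w a⟫) hlam'
    have h2 := Finset.sum_mul_le_of_le_off_subset {a} (fun i => sq_nonneg ⟪w i, u a⟫) hmu'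
    rw [← hAx, parseval u _ hwa, Finset.sum_singleton, Finset.sum_singleton] at h1
    rw [← hBx, parseval w _ hua, Finset.sum_singleton, Finset.sum_singleton] at h2
    have h3 := w.orthonormal.inner_sq_add_inner_sq_le hab (u a)
    rw [hua] at h3
    nlinarith [sq_nonneg ⟪w b, u a⟫]
  have bottom : (lam b - c) * (1 - (⟪u b, w a⟫ ^ 2 + ⟪u b, w b⟫ ^ 2)) ≤ 4 * ε := by
    have h1 := Finset.sum_mul_le_of_le_off_subset {a, b}
      (p := fun i => ⟪u i, w a⟫ ^ 2 + ⟪u i, w b⟫ ^ 2) (fun i => by positivity)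
      (l := lam) (c := c) (fun i hi => hlam i (by simp_all) (by simp_all))
    have h2 := Finset.sum_mul_le_of_le_off_subset {a}
      (p := fun i => ⟪w i, u a⟫ ^ 2 + ⟪w i, u b⟫ ^ 2) (fun i => by positivity) hmu'
    simp only [mul_add, Finset.sum_add_distrib, ← hAx, parseval u _ hwa, parseval u _ hwb,
      Finset.sum_pair hab] at h1
    simp only [mul_add, Finset.sum_add_distrib, ← hBx, parseval w _ hua, parseval w _ hub,
      Finset.sum_singleton] at h2
    have h3 := w.orthonormal.inner_sq_add_inner_sq_le hab (u a)
    have h4 := u.orthonormal.inner_sq_add_inner_sq_le hab (w a)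
    rw [hua, real_inner_comm, real_inner_comm (u a) (w b)] at h3
    rw [hwa, real_inner_comm, real_inner_comm (w a) (u b)] at h4
    have k1 : 0 ≤ (lam a - c) * (1 - (⟪u a, w a⟫ ^ 2 + ⟪u a, w b⟫ ^ 2)) :=
      mul_nonneg (by linarith) (by linarith)
    have k2 : 0 ≤ (mu a - mu b) * (1 - (⟪w a, u a⟫ ^ 2 + ⟪w a, u b⟫ ^ 2)) :=
      mul_nonneg (by linarith) (by linarith)
    linarith
  have cross : ⟪u b, w a⟫ ^ 2 ≤ 1 - ⟪u a, w a⟫ ^ 2 := by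
    have h := u.orthonormal.inner_sq_add_inner_sq_le hab (w a)
    rw [hwa] at h
    linarith
  have top' : 1 - ⟪u a, w a⟫ ^ 2 ≤ 2 * ε / (lam a - lam b) := by
    rw [le_div_iff₀' (sub_pos.mpr hgap₁)]
    exact top
  have bottom' : 1 - (⟪u b, w a⟫ ^ 2 + ⟪u b, w b⟫ ^ 2) ≤ 4 * ε / (lam b - c) := by
    rw [le_div_iff₀' (sub_pos.mpr hgap₂)]
    exact bottom
  have f1 : 4 * ε / (lam a - lam b) = 2 * (2 * ε / (lam a - lam b)) := by ring
  have f2 : 8 * ε / (lam b - c) = 2 * (4 * ε / (lam b - c)) := by ring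
  have n1 := norm_sub_sq_le_of_inner_nonneg hua hwa hsign₁
  have n2 := norm_sub_sq_le_of_inner_nonneg hub hwb hsign₂
  rw [f1, f2]
  constructor <;> linarith

lemma Orthonormal.exists_orthonormalBasis_coe_eq {n : ℕ} {v : Fin n → EuclideanSpace ℝ (Fin n)}
    (hv : Orthonormal ℝ v) : ∃ b : OrthonormalBasis (Fin n) ℝ (EuclideanSpace ℝ (Fin n)), ⇑b = v :=
  ⟨OrthonormalBasis.mk hv
    (hv.linearIndependent.span_eq_top_of_card_eq_finrank' (by simp)).ge, by simp⟩

lemma Matrix.toEuclideanCLM_apply_eq_smul {n : ℕ} {A : Matrix (Fin n) (Fin n) ℝ} {c : ℝ}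
    {x : EuclideanSpace ℝ (Fin n)} (h : ∀ i, ∑ j, A i j * x j = c * x i) :
    Matrix.toEuclideanCLM (𝕜 := ℝ) A x = c • x := by
  ext i
  simpa [Matrix.mulVec, dotProduct] using h i

end Auxiliary

/-- **Eigenvector perturbation (Lemma 4(b), 'MatBound').**
Let `Σ`, `M` be symmetric `n×n` matrices, with eigenvalues `λ₁ > λ₂ > λ₃ ≥ … ≥ λₙ`
of `Σ` (orthonormal eigenvectors `u₁, …, uₙ`) and orthonormal eigenvectors
`ũ₁, ũ₂` of `M` for its two largest eigenvalues, signs fixed by `⟨u₁,ũ₁⟩ ≥ 0`,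
`⟨u₂,ũ₂⟩ ≥ 0`.  If `‖M − Σ‖ ≤ ε < (λ₂ − λ₃)/2` then
`‖u₁ − ũ₁‖² ≤ 4ε/(λ₁ − λ₂)` and `‖u₂ − ũ₂‖² ≤ 4ε/(λ₁ − λ₂) + 8ε/(λ₂ − λ₃)`. -/
theorem eigenvector_perturbation
    (n : ℕ) [NeZero n] (hn : 3 ≤ n)
    (S M : Matrix (Fin n) (Fin n) ℝ) (hS : S.IsHermitian) (hM : M.IsHermitian)
    (lam : Fin n → ℝ) (hlam : Antitone lam)
    (hgap₁ : lam 1 < lam 0) (hgap₂ : lam 2 < lam 1)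
    (u : Fin n → EuclideanSpace ℝ (Fin n)) (hu : Orthonormal ℝ u)
    (hSu : ∀ m i, ∑ j, S i j * u m j = lam m * u m i)
    (mu : Fin n → ℝ) (hmu : Antitone mu)
    (w : Fin n → EuclideanSpace ℝ (Fin n)) (hw : Orthonormal ℝ w)
    (hMw : ∀ m i, ∑ j, M i j * w m j = mu m * w m i)
    (hsign₁ : 0 ≤ ⟪u 0, w 0⟫) (hsign₂ : 0 ≤ ⟪u 1, w 1⟫)
    (ε : ℝ) (hε : ‖Matrix.toEuclideanCLM (𝕜 := ℝ) (M - S)‖ ≤ ε)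
    (hεgap : ε < (lam 1 - lam 2) / 2) :
    ‖u 0 - w 0‖ ^ 2 ≤ 4 * ε / (lam 0 - lam 1) ∧
    ‖u 1 - w 1‖ ^ 2 ≤ 4 * ε / (lam 0 - lam 1) + 8 * ε / (lam 1 - lam 2) := by
  obtain ⟨b, rfl⟩ := hu.exists_orthonormalBasis_coe_eq
  obtain ⟨d, rfl⟩ := hw.exists_orthonormalBasis_coe_eq
  obtain ⟨k, rfl⟩ := Nat.exists_eq_add_of_le' hn
  have v1 : ((1 : Fin (k + 3)) : ℕ) = 1 := rfl
  have v2 : ((2 : Fin (k + 3)) : ℕ) = 2 := rfl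
  have one_le (i : Fin (k + 3)) (h : i ≠ 0) : 1 ≤ i := by
    rw [Ne, Fin.ext_iff, Fin.val_zero] at h
    rw [Fin.le_def]
    omega
  have two_le (i : Fin (k + 3)) (h0 : i ≠ 0) (h1 : i ≠ 1) : 2 ≤ i := by
    rw [Ne, Fin.ext_iff, Fin.val_zero] at h0
    rw [Ne, Fin.ext_iff, v1] at h1
    rw [Fin.le_def]
    omega
  rw [map_sub] at hε
  exact b.eigenvector_perturbation_bounds d
    (fun i => Matrix.toEuclideanCLM_apply_eq_smul (hSu i))
    (fun i => Matrix.toEuclideanCLM_apply_eq_smul (hMw i))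
    (by intro h; simp [h] at hgap₁) hgap₁ hgap₂ (fun i h0 h1 => hlam (two_le i h0 h1))
    (hmu (Fin.zero_le _)) (fun i h => hmu (one_le i h)) hsign₁ hsign₂ hε
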